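/- Let 𝓕 be a semigroup of transcendental entire functions (a nonempty family of transcendental entire functions closed under composition) such that the escaping like set I(𝓕) has at least two points and is invariant, i.e. both forward invariant (f(I(𝓕)) ⊆ I(𝓕) for every f ∈ 𝓕) and backward invariant (f⁻¹(I(𝓕)) ⊆ I(𝓕) for every f ∈ 𝓕). Then J(𝓕) = ∂I(𝓕), the boundary of I(𝓕) in ℂ. -/

import Mathlib

open Filter Topology Set

/-- Locally uniform divergence to `∞` on the set `s`: on every compact subset of `s`,
the moduli eventually exceed every bound, uniformly. -/
def TendstoLocallyUniformlyOnInfty (F : ℕ → ℂ → ℂ) (s : Set ℂ) : Prop :=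
  ∀ K ⊆ s, IsCompact K → ∀ M : ℝ, ∀ᶠ n in Filter.atTop, ∀ z ∈ K, M ≤ ‖F n z‖

/-- The family `𝓕` of functions holomorphic on `D` is normal at `z₀ ∈ D`: there is a
neighborhood `N ⊆ D` of `z₀` on which every sequence from `𝓕` has a subsequence converging
locally uniformly either to a holomorphic function or to `∞`. -/
def NormalAt (D : Set ℂ) (𝓕 : Set (ℂ → ℂ)) (z₀ : ℂ) : Prop :=
  ∃ N, N ⊆ D ∧ N ∈ 𝓝 z₀ ∧ ∀ f : ℕ → ℂ → ℂ, (∀ n, f n ∈ 𝓕) →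
    ∃ φ : ℕ → ℕ, StrictMono φ ∧
      ((∃ g : ℂ → ℂ, DifferentiableOn ℂ g N ∧
          TendstoLocallyUniformlyOn (fun n => f (φ n)) g Filter.atTop N) ∨
        TendstoLocallyUniformlyOnInfty (fun n => f (φ n)) N)

/-- The Fatou like set of `𝓕` on `D`: points of `D` where `𝓕` is normal. -/
def FatouSet (D : Set ℂ) (𝓕 : Set (ℂ → ℂ)) : Set ℂ := {z | z ∈ D ∧ NormalAt D 𝓕 z}

/-- The Julia like set of `𝓕` on `D`. -/
def JuliaSet (D : Set ℂ) (𝓕 : Set (ℂ → ℂ)) : Set ℂ := D \ FatouSet D 𝓕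

/-- The backward orbit of `z` with respect to `𝓕`. -/
def BackwardOrbit (D : Set ℂ) (𝓕 : Set (ℂ → ℂ)) (z : ℂ) : Set ℂ :=
  {w | w ∈ D ∧ ∃ f ∈ 𝓕, f w = z}

/-- The exceptional set of `𝓕`: points with finite backward orbit. -/
def ExceptionalSet (D : Set ℂ) (𝓕 : Set (ℂ → ℂ)) : Set ℂ :=
  {z | (BackwardOrbit D 𝓕 z).Finite}

/-- The escaping like set `I(𝓕)`: points `z ∈ D` such that `f n z → ∞` for every
infinite (i.e. injective) sequence `f` in `𝓕`. -/
def EscapingSet (D : Set ℂ) (𝓕 : Set (ℂ → ℂ)) : Set ℂ :=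
  {z | z ∈ D ∧ ∀ f : ℕ → ℂ → ℂ, (∀ n, f n ∈ 𝓕) → Function.Injective f →
    Filter.Tendsto (fun n => ‖f n z‖) Filter.atTop Filter.atTop}

/-- The generalized escaping like set `U(𝓕)`: points `z ∈ D` such that `f n z → ∞` for some
sequence `f` in `𝓕`. -/
def GenEscapingSet (D : Set ℂ) (𝓕 : Set (ℂ → ℂ)) : Set ℂ :=
  {z | z ∈ D ∧ ∃ f : ℕ → ℂ → ℂ, (∀ n, f n ∈ 𝓕) ∧
    Filter.Tendsto (fun n => ‖f n z‖) Filter.atTop Filter.atTop}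

/-- A transcendental entire function: entire and not a polynomial. -/
def TranscendentalEntire (f : ℂ → ℂ) : Prop :=
  Differentiable ℂ f ∧ ¬ ∃ p : Polynomial ℂ, ∀ z, f z = p.eval z

/-- Boundary of `A` relative to `D`; for `D` open and `A ⊆ D` this coincides with the
boundary of `A` in the subspace topology of `D`. -/
def relBoundary (D A : Set ℂ) : Set ℂ := D ∩ frontier A

/-- Closure of `A` in `D`; for `D` open and `A ⊆ D` this coincides with the closure of `A`
in the subspace topology of `D`. -/
def relClosure (D A : Set ℂ) : Set ℂ := D ∩ closure A


lemma aux_exists_log {U : Set ℂ} (hU : IsOpen U) (hc : Convex ℝ U) (hne : U.Nonempty) {f : ℂ → ℂ}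
    (hf : DifferentiableOn ℂ f U) (h0 : ∀ z ∈ U, f z ≠ 0) :
    ∃ L : ℂ → ℂ, DifferentiableOn ℂ L U ∧ ∀ z ∈ U, Complex.exp (L z) = f z := by
  have hsc : IsSimplyConnected U := by
    have := hc.contractibleSpace hne
    show SimplyConnectedSpace U
    infer_instance
  obtain ⟨L, hLc, hL⟩ := Complex.exists_continuousOn_eqOn_exp_comp hsc hU hf.continuousOn
    (by rintro ⟨z, hz, h⟩; exact h0 z hz h)
  refine ⟨L, ?_, fun z hz => hL hz⟩
  intro z hz
  apply DifferentiableAt.differentiableWithinAt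
  have hUz := hU.mem_nhds hz
  have hca : ContinuousAt L z := hLc.continuousAt hUz
  have hfd : DifferentiableAt ℂ f z := hf.differentiableAt hUz
  have h1 : DifferentiableAt ℂ (fun w => L z + Complex.log (f w / f z)) z := by
    apply DifferentiableAt.const_add
    apply DifferentiableAt.clog (hfd.div_const _)
    rw [div_self (h0 z hz)]
    exact Complex.one_mem_slitPlane
  refine h1.congr_of_eventuallyEq ?_
  have h2 : ∀ᶠ w in 𝓝 z, dist (L w) (L z) < 3 := hca.eventually (Metric.ball_mem_nhds _ (by norm_num))
  filter_upwards [h2, hUz] with w hw hwU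
  have e : f w / f z = Complex.exp (L w - L z) := by
    rw [Complex.exp_sub]
    have a := hL hwU
    have b := hL hz
    simp only [Function.comp] at a b
    rw [a, b]
  have h3 : |(L w - L z).im| < 3 := by
    refine lt_of_le_of_lt (Complex.abs_im_le_norm _) ?_
    rwa [dist_eq_norm] at hw
  rw [abs_lt] at h3
  rw [e, Complex.log_exp (by linarith [Real.pi_gt_three]) (by linarith [Real.pi_gt_three])]
  ring

lemma aux_abs_im_le_norm_cos (w : ℂ) : |w.im| ≤ ‖Complex.cos w‖ := by
  have h1 : |w.im| ≤ |Real.sinh w.im| := by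
    rw [Real.abs_sinh]
    exact Real.self_le_sinh_iff.2 (abs_nonneg _)
  refine h1.trans ?_
  rw [Complex.cos, norm_div, Real.sinh_eq, abs_div]
  have h2 := abs_norm_sub_norm_le (Complex.exp (w * Complex.I)) (-Complex.exp (-w * Complex.I))
  rw [norm_neg, Complex.norm_exp, Complex.norm_exp, sub_neg_eq_add] at h2
  simp at h2
  rw [abs_sub_comm] at h2
  simp
  gcongr

lemma aux_exists_arccos {U : Set ℂ} (hU : IsOpen U) (hc : Convex ℝ U) {z₀ : ℂ} (hz₀ : z₀ ∈ U)
    {f : ℂ → ℂ} (hf : DifferentiableOn ℂ f U) (h1 : ∀ z ∈ U, f z ≠ 1) (h2 : ∀ z ∈ U, f z ≠ -1) :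
    ∃ F : ℂ → ℂ, DifferentiableOn ℂ F U ∧ (∀ z ∈ U, Complex.cos (Real.pi * F z) = f z) ∧
      ‖F z₀‖ ≤ 1 + ‖f z₀‖ := by
  have hpi : (Real.pi : ℂ) ≠ 0 := by exact_mod_cast Real.pi_ne_zero
  obtain ⟨L, hL, hLe⟩ := aux_exists_log hU hc ⟨z₀, hz₀⟩ (f := fun z => 1 - f z ^ 2)
    (by fun_prop) (by
      intro z hz h
      have : (f z - 1) * (f z + 1) = 0 := by linear_combination -h
      rcases mul_eq_zero.1 this with h | h
      · exact h1 z hz (by linear_combination h)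
      · exact h2 z hz (by linear_combination h))
  set s : ℂ → ℂ := fun z => Complex.exp (L z / 2) with hs
  have hsd : DifferentiableOn ℂ s U := by
    apply DifferentiableOn.cexp
    exact hL.div_const 2
  have hs2 : ∀ z ∈ U, s z ^ 2 = 1 - f z ^ 2 := by
    intro z hz
    rw [← hLe z hz, hs]
    simp only
    rw [← Complex.exp_nat_mul]
    congr 1
    push_cast
    ring
  have hprod : ∀ z ∈ U, (f z + Complex.I * s z) * (f z - Complex.I * s z) = 1 := by
    intro z hz
    have := hs2 z hz
    linear_combination this - s z ^ 2 * Complex.I_sq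
  obtain ⟨A, hA, hAe⟩ := aux_exists_log hU hc ⟨z₀, hz₀⟩ (f := fun z => f z + Complex.I * s z)
    (by fun_prop) (by
      intro z hz h
      have := hprod z hz
      rw [h] at this
      simp at this)
  have hcos : ∀ z ∈ U, Complex.cos (A z / Complex.I) = f z := by
    intro z hz
    have e1 : A z / Complex.I * Complex.I = A z := div_mul_cancel₀ _ Complex.I_ne_zero
    rw [Complex.cos, neg_mul, e1, Complex.exp_neg, hAe z hz]
    have e2 : (f z + Complex.I * s z)⁻¹ = f z - Complex.I * s z := by
      exact inv_eq_of_mul_eq_one_right (hprod z hz)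
    rw [e2]; ring
  set k : ℤ := round ((A z₀ / Complex.I / Real.pi).re / 2) with hk
  have hcos' : ∀ z ∈ U, Complex.cos (Real.pi * (A z / Complex.I / Real.pi - 2 * k)) = f z := by
    intro z hz
    rw [← hcos z hz, ← Complex.cos_sub_int_mul_two_pi (A z / Complex.I) k]
    congr 1
    field_simp
  refine ⟨fun z => A z / Complex.I / Real.pi - 2 * k, ?_, hcos', ?_⟩
  · exact ((hA.div_const _).div_const _).sub_const _
  · refine (Complex.norm_le_abs_re_add_abs_im _).trans (add_le_add ?_ ?_)
    · have := abs_sub_round ((A z₀ / Complex.I / Real.pi).re / 2)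
      rw [← hk] at this
      have e : (A z₀ / Complex.I / Real.pi - 2 * k).re = 2 * ((A z₀ / Complex.I / Real.pi).re / 2 - k) := by
        simp
        ring
      rw [e, abs_mul, abs_two]
      linarith
    · rw [← hcos' z₀ hz₀]
      refine le_trans ?_ (aux_abs_im_le_norm_cos _)
      rw [Complex.im_ofReal_mul, abs_mul, abs_of_pos Real.pi_pos]
      have h3 := Real.pi_gt_three
      have h4 := abs_nonneg (A z₀ / Complex.I / Real.pi - 2 * k).im
      nlinarith

lemma aux_cos_int (k : ℤ) : Complex.cos (Real.pi * k) = 1 ∨ Complex.cos (Real.pi * k) = -1 := by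
  have h : Complex.sin (Real.pi * k) = 0 := by
    rw [mul_comm]; exact Complex.sin_int_mul_pi k
  have h2 := Complex.sin_sq_add_cos_sq (Real.pi * k)
  rw [h] at h2
  have h3 : (Complex.cos (Real.pi * k)) ^ 2 = 1 := by linear_combination h2
  simpa using h3

lemma aux_net (w : ℂ) : ∃ v ∈ Metric.ball w 2, ∃ k : ℤ, Complex.cos (Real.pi * v) = k := by
  have hpi := Real.pi_gt_three
  set a := Real.pi * |w.im| with ha
  have ha0 : 0 ≤ a := by positivity
  set m : ℤ := ⌈Real.cosh a⌉ with hm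
  have hm1 : Real.cosh a ≤ m := Int.le_ceil _
  have hm2 : (m : ℝ) < Real.cosh a + 1 := Int.ceil_lt_add_one _
  have hb : (m : ℝ) ≤ Real.cosh (a + Real.pi) := by
    have h1 : Real.cosh a + 1 ≤ Real.cosh (a + Real.pi) := by
      rw [Real.cosh_add]
      have h2 : 0 ≤ Real.sinh a * Real.sinh Real.pi :=
        mul_nonneg (Real.sinh_nonneg_iff.2 ha0) (Real.sinh_nonneg_iff.2 Real.pi_pos.le)
      have h3 : 1 ≤ Real.cosh a := Real.one_le_cosh a
      have h4 : 2 ≤ Real.cosh Real.pi := by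
        rw [Real.cosh_eq]
        have := Real.add_one_le_exp Real.pi
        have := Real.exp_pos (-Real.pi)
        linarith
      nlinarith
    linarith
  obtain ⟨t, ht, htm⟩ := intermediate_value_Icc (by linarith : a ≤ a + Real.pi)
    Real.continuous_cosh.continuousOn ⟨hm1, hb⟩
  set n : ℤ := round w.re
  obtain ⟨y, hy1, hy2⟩ : ∃ y : ℝ, |w.im - y| ≤ 1 ∧ Real.cosh (Real.pi * y) = m := by
    have e1 : |w.im| ≤ t / Real.pi := by rw [le_div_iff₀ Real.pi_pos]; linarith [ht.1]
    have e2 : t / Real.pi ≤ |w.im| + 1 := by rw [div_le_iff₀ Real.pi_pos]; linarith [ht.2]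
    rcases le_total 0 w.im with h | h
    · refine ⟨t / Real.pi, ?_, ?_⟩
      · rw [abs_of_nonneg h] at e1 e2
        rw [abs_le]; constructor <;> linarith
      · rw [mul_div_cancel₀ _ Real.pi_ne_zero]; exact htm
    · refine ⟨-(t / Real.pi), ?_, ?_⟩
      · rw [abs_of_nonpos h] at e1 e2
        rw [abs_le]; constructor <;> linarith
      · rw [mul_neg, Real.cosh_neg, mul_div_cancel₀ _ Real.pi_ne_zero]; exact htm
  refine ⟨n + y * Complex.I, ?_, ?_⟩
  · rw [Metric.mem_ball, dist_comm, dist_eq_norm]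
    refine lt_of_le_of_lt (Complex.norm_le_abs_re_add_abs_im _) ?_
    have := abs_sub_round w.re
    simp
    linarith
  · have e : (Real.pi : ℂ) * (n + y * Complex.I) = ((Real.pi * y : ℝ) : ℂ) * Complex.I + n * Real.pi := by
      push_cast; ring
    have hs : Complex.sin (n * Real.pi) = 0 := Complex.sin_int_mul_pi n
    rw [e, Complex.cos_add, hs, Complex.cos_mul_I, ← Complex.ofReal_cosh, hy2, mul_comm (n : ℂ)]
    rcases aux_cos_int n with h | h
    · exact ⟨m, by rw [h]; simp⟩
    · exact ⟨-m, by rw [h]; simp⟩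

lemma aux_exists_G {U : Set ℂ} (hU : IsOpen U) (hc : Convex ℝ U) {z₀ : ℂ} (hz₀ : z₀ ∈ U)
    {f : ℂ → ℂ} (hf : DifferentiableOn ℂ f U) (h0 : ∀ z ∈ U, f z ≠ 0) (h1 : ∀ z ∈ U, f z ≠ 1) :
    ∃ G : ℂ → ℂ, DifferentiableOn ℂ G U ∧
      (∀ z ∈ U, f z = (1 + Complex.cos (Real.pi * Complex.cos (Real.pi * G z))) / 2) ∧
      ‖G z₀‖ ≤ 3 + 2 * ‖f z₀‖ ∧ ∀ w, ¬ Metric.ball w 2 ⊆ G '' U := by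
  obtain ⟨F, hF, hFe, hFn⟩ := aux_exists_arccos hU hc hz₀ (f := fun z => 2 * f z - 1)
    (by fun_prop) (fun z hz h => h1 z hz (by linear_combination h / 2))
    (fun z hz h => h0 z hz (by linear_combination h / 2))
  have hint : ∀ z ∈ U, ∀ k : ℤ, F z ≠ k := by
    intro z hz k hk
    have := hFe z hz
    rw [hk] at this
    rcases aux_cos_int k with h | h
    · exact h1 z hz (by linear_combination (h - this) / 2)
    · exact h0 z hz (by linear_combination (h - this) / 2)
  obtain ⟨G, hG, hGe, hGn⟩ := aux_exists_arccos hU hc hz₀ hF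
    (fun z hz h => hint z hz 1 (by simpa using h))
    (fun z hz h => hint z hz (-1) (by simpa using h))
  refine ⟨G, hG, ?_, ?_, ?_⟩
  · intro z hz
    rw [hGe z hz, hFe z hz]; ring
  · have : ‖2 * f z₀ - 1‖ ≤ 2 * ‖f z₀‖ + 1 := by
      refine (norm_sub_le _ _).trans ?_
      simp
    linarith
  · intro w hw
    obtain ⟨v, hv, k, hk⟩ := aux_net w
    obtain ⟨z, hz, rfl⟩ := hw hv
    rw [hGe z hz] at hk
    exact hint z hz k hk

lemma aux_bloch {U : Set ℂ} (hU : IsOpen U) {f : ℂ → ℂ} (hf : DifferentiableOn ℂ f U)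
    (hno : ∀ w, ¬ Metric.ball w 2 ⊆ f '' U) {z₀ : ℂ} {R : ℝ} (hR : 0 < R)
    (hsub : Metric.closedBall z₀ R ⊆ U) : R * ‖deriv f z₀‖ ≤ 96 := by
  by_contra hcon
  push Not at hcon
  have hd : DifferentiableOn ℂ (deriv f) U := hf.deriv hU
  have hcont : ContinuousOn (fun z => ‖deriv f z‖ * (R - ‖z - z₀‖)) (Metric.closedBall z₀ R) := by
    have := (hd.mono hsub).continuousOn
    fun_prop
  obtain ⟨p, hp, hmax⟩ := (isCompact_closedBall z₀ R).exists_isMaxOn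
    ⟨z₀, Metric.mem_closedBall_self hR.le⟩ hcont
  have hmax' : ∀ z ∈ Metric.closedBall z₀ R,
      ‖deriv f z‖ * (R - ‖z - z₀‖) ≤ ‖deriv f p‖ * (R - ‖p - z₀‖) := fun z hz => hmax hz
  have h1 := hmax' z₀ (Metric.mem_closedBall_self hR.le)
  rw [sub_self, norm_zero, sub_zero] at h1
  set D := ‖deriv f p‖ with hD
  obtain ⟨t, ht⟩ : ∃ t, t = (R - ‖p - z₀‖) / 2 := ⟨_, rfl⟩
  have hpn : ‖p - z₀‖ ≤ R := by rw [← dist_eq_norm]; exact hp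
  have hDt : 48 < D * t := by rw [ht]; linarith
  have hD0 : 0 ≤ D := norm_nonneg _
  have ht0 : 0 < t := by
    rcases (show 0 ≤ t by rw [ht]; linarith).eq_or_lt with h | h
    · rw [← h] at hDt; linarith
    · exact h
  have hDpos : 0 < D := by
    rcases hD0.eq_or_lt with h | h
    · rw [← h] at hDt; linarith
    · exact h
  have hball : Metric.ball p t ⊆ Metric.closedBall z₀ R := by
    intro z hz
    rw [Metric.mem_ball] at hz
    rw [Metric.mem_closedBall]
    have := dist_triangle z p z₀
    rw [dist_eq_norm p z₀] at this
    linarith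
  have h2 : ∀ z ∈ Metric.ball p t, ‖deriv f z‖ ≤ 2 * D := by
    intro z hz
    have a := hmax' z (hball hz)
    have b : t ≤ R - ‖z - z₀‖ := by
      rw [Metric.mem_ball] at hz
      have := dist_triangle z p z₀
      rw [dist_eq_norm p z₀, dist_eq_norm z z₀] at this
      linarith
    have c : ‖deriv f z‖ * t ≤ ‖deriv f z‖ * (R - ‖z - z₀‖) := by gcongr
    have d : ‖deriv f z‖ * t ≤ (2 * D) * t := by
      have : D * (R - ‖p - z₀‖) = 2 * D * t := by rw [ht]; ring
      linarith
    exact le_of_mul_le_mul_right d ht0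
  have h3 : ∀ z ∈ Metric.ball p t, dist (deriv f z) (deriv f p) ≤ 3 * D / t * dist z p := by
    intro z hz
    apply Complex.dist_le_div_mul_dist_of_mapsTo_ball (hd.mono (hball.trans hsub)) _ hz
    intro w hw
    rw [Metric.mem_closedBall, dist_eq_norm]
    refine (norm_sub_le _ _).trans ?_
    have := h2 w hw
    linarith
  have hρsub : Metric.closedBall p (t / 6) ⊆ Metric.ball p t :=
    Metric.closedBall_subset_ball (by linarith)
  have hfdiff : ∀ z ∈ Metric.ball p t, DifferentiableAt ℂ f z := fun z hz =>
    hf.differentiableAt (hU.mem_nhds (hsub (hball hz)))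
  have h4 : ∀ z ∈ Metric.closedBall p (t / 6),
      ‖(f z - deriv f p * z) - (f p - deriv f p * p)‖ ≤ D / 2 * ‖z - p‖ := by
    intro z hz
    apply (convex_closedBall p (t / 6)).norm_image_sub_le_of_norm_hasDerivWithin_le
      (f := fun z => f z - deriv f p * z) (f' := fun z => deriv f z - deriv f p)
      _ _ (Metric.mem_closedBall_self (by linarith)) hz
    · intro w hw
      have := ((hfdiff w (hρsub hw)).hasDerivAt.sub ((hasDerivAt_id w).const_mul (deriv f p)))
      rw [mul_one] at this
      exact this.hasDerivWithinAt
    · intro w hw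
      have a := h3 w (hρsub hw)
      rw [← dist_eq_norm]
      refine a.trans ?_
      have : dist w p ≤ t / 6 := hw
      calc 3 * D / t * dist w p ≤ 3 * D / t * (t / 6) := by gcongr
        _ = D / 2 := by field_simp; norm_num
  have h5 : ∀ z ∈ Metric.sphere p (t / 6), D * t / 12 ≤ ‖f z - f p‖ := by
    intro z hz
    have a := h4 z (Metric.sphere_subset_closedBall hz)
    have b : ‖z - p‖ = t / 6 := by rw [← dist_eq_norm]; exact hz
    have c : ‖deriv f p * (z - p)‖ = D * (t / 6) := by rw [norm_mul, b]
    have d := norm_sub_norm_le (deriv f p * (z - p)) (-((f z - deriv f p * z) - (f p - deriv f p * p)))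
    have e : deriv f p * (z - p) - (-((f z - deriv f p * z) - (f p - deriv f p * p))) = f z - f p := by
      ring
    rw [e, norm_neg, c] at d
    rw [b] at a
    linarith
  have hpb : p ∈ Metric.ball p t := Metric.mem_ball_self ht0
  have hdc : DiffContOnCl ℂ f (Metric.ball p (t / 6)) := by
    apply DifferentiableOn.diffContOnCl
    rw [closure_ball _ (by linarith : t / 6 ≠ 0).symm.symm]
    exact fun z hz => (hfdiff z (hρsub hz)).differentiableWithinAt
  have h6 := hdc.ball_subset_image_closedBall (by linarith) h5 (by
    have := (hfdiff p hpb).hasDerivAt.eventually_ne (norm_pos_iff.1 hDpos) (c := f p)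
    exact this.frequently.filter_mono nhdsWithin_le_nhds)
  apply hno (f p)
  refine (Metric.ball_subset_ball ?_).trans (h6.trans (image_mono (hρsub.trans (hball.trans hsub))))
  linarith

lemma aux_norm_cos_le (w : ℂ) : ‖Complex.cos w‖ ≤ Real.exp ‖w‖ := by
  rw [Complex.cos, norm_div]
  have h1 : ‖Complex.exp (w * Complex.I)‖ ≤ Real.exp ‖w‖ := by
    refine (Complex.norm_exp_le_exp_norm _).trans ?_
    simp
  have h2 : ‖Complex.exp (-w * Complex.I)‖ ≤ Real.exp ‖w‖ := by
    refine (Complex.norm_exp_le_exp_norm _).trans ?_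
    simp
  have h3 := norm_add_le (Complex.exp (w * Complex.I)) (Complex.exp (-w * Complex.I))
  simp only [Complex.norm_ofNat]
  linarith

lemma aux_schottky (M : ℝ) : ∃ S : ℝ, 0 < S ∧ ∀ (z₀ : ℂ) (r : ℝ) (f : ℂ → ℂ), 0 < r →
    DifferentiableOn ℂ f (Metric.ball z₀ r) → (∀ z ∈ Metric.ball z₀ r, f z ≠ 0) →
    (∀ z ∈ Metric.ball z₀ r, f z ≠ 1) → ‖f z₀‖ ≤ M →
    ∀ z ∈ Metric.closedBall z₀ (r / 2), ‖f z‖ ≤ S := by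
  refine ⟨(1 + Real.exp (Real.pi * Real.exp (Real.pi * (195 + 2 * M)))) / 2, by positivity, ?_⟩
  intro z₀ r f hr hf h0 h1 hM z hz
  obtain ⟨G, hG, hGe, hGn, hno⟩ := aux_exists_G Metric.isOpen_ball (convex_ball z₀ r)
    (Metric.mem_ball_self hr) hf h0 h1
  have hsub : Metric.closedBall z₀ (r / 2) ⊆ Metric.ball z₀ r :=
    Metric.closedBall_subset_ball (by linarith)
  have hder : ∀ w ∈ Metric.closedBall z₀ (r / 2), ‖deriv G w‖ ≤ 384 / r := by
    intro w hw
    have := aux_bloch Metric.isOpen_ball hG hno (z₀ := w) (R := r / 4) (by linarith) (by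
      intro v hv
      rw [Metric.mem_closedBall] at hv hw
      rw [Metric.mem_ball]
      have := dist_triangle v w z₀
      linarith)
    rw [le_div_iff₀ hr]
    linarith
  have hlip : ‖G z - G z₀‖ ≤ 384 / r * ‖z - z₀‖ :=
    (convex_closedBall z₀ (r / 2)).norm_image_sub_le_of_norm_deriv_le
      (fun w hw => hG.differentiableAt (Metric.isOpen_ball.mem_nhds (hsub hw))) hder
      (Metric.mem_closedBall_self (by linarith)) hz
  have hz' : ‖z - z₀‖ ≤ r / 2 := by rw [← dist_eq_norm]; exact hz
  have h2 : ‖G z - G z₀‖ ≤ 192 := by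
    refine hlip.trans ?_
    calc 384 / r * ‖z - z₀‖ ≤ 384 / r * (r / 2) := by gcongr
      _ = 192 := by field_simp; norm_num
  have h3 : ‖G z‖ ≤ 195 + 2 * M := by
    have := norm_sub_norm_le (G z) (G z₀)
    linarith
  have hn : ∀ w : ℂ, ‖(Real.pi : ℂ) * w‖ = Real.pi * ‖w‖ := by
    intro w
    rw [norm_mul, Complex.norm_real, Real.norm_of_nonneg Real.pi_pos.le]
  have h4 : ‖Complex.cos (Real.pi * G z)‖ ≤ Real.exp (Real.pi * (195 + 2 * M)) := by
    refine (aux_norm_cos_le _).trans ?_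
    rw [hn]
    gcongr
  have h5 : ‖Complex.cos (Real.pi * Complex.cos (Real.pi * G z))‖ ≤
      Real.exp (Real.pi * Real.exp (Real.pi * (195 + 2 * M))) := by
    refine (aux_norm_cos_le _).trans ?_
    rw [hn]
    gcongr
  rw [hGe z (hsub hz), norm_div]
  simp only [Complex.norm_ofNat]
  gcongr
  refine (norm_add_le _ _).trans ?_
  rw [norm_one]
  linarith

lemma aux_picard {f : ℂ → ℂ} (hf : Differentiable ℂ f) (h0 : ∀ z, f z ≠ 0) (h1 : ∀ z, f z ≠ 1) :
    ∀ z w, f z = f w := by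
  obtain ⟨G, hG, hGe, -, hno⟩ := aux_exists_G isOpen_univ convex_univ (mem_univ 0)
    hf.differentiableOn (fun z _ => h0 z) (fun z _ => h1 z)
  have hd : ∀ z, deriv G z = 0 := by
    intro z
    by_contra h
    have hpos : 0 < ‖deriv G z‖ := norm_pos_iff.2 h
    have := aux_bloch isOpen_univ hG hno (z₀ := z) (R := 97 / ‖deriv G z‖) (by positivity)
      (subset_univ _)
    rw [div_mul_cancel₀ _ hpos.ne'] at this
    norm_num at this
  have hGd : Differentiable ℂ G := differentiableOn_univ.1 hG
  intro z w
  rw [hGe z (mem_univ _), hGe w (mem_univ _), is_const_of_deriv_eq_zero hGd hd z w]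

lemma aux_montel {z₀ : ℂ} {r M : ℝ} (hr : 0 < r) (f : ℕ → ℂ → ℂ)
    (hf : ∀ n, DifferentiableOn ℂ (f n) (Metric.ball z₀ r))
    (hM : ∀ n, ∀ z ∈ Metric.ball z₀ r, ‖f n z‖ ≤ M) :
    ∃ φ : ℕ → ℕ, StrictMono φ ∧ ∃ g : ℂ → ℂ, DifferentiableOn ℂ g (Metric.ball z₀ (r / 4)) ∧
      TendstoLocallyUniformlyOn (fun n => f (φ n)) g atTop (Metric.ball z₀ (r / 4)) := by
  set K := Metric.closedBall z₀ (r / 4) with hK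
  have hKsub : K ⊆ Metric.ball z₀ r := Metric.closedBall_subset_ball (by linarith)
  have hlip : ∀ n, ∀ z ∈ K, ∀ w ∈ K,
      dist (f n z) (f n w) ≤ (2 * M) / (3 * r / 4) * dist z w := by
    intro n z hz w hw
    rw [hK, Metric.mem_closedBall] at hz hw
    have hb : Metric.ball w (3 * r / 4) ⊆ Metric.ball z₀ r := Metric.ball_subset_ball' (by linarith)
    apply Complex.dist_le_div_mul_dist_of_mapsTo_ball ((hf n).mono hb)
    · intro v hv
      rw [Metric.mem_closedBall, dist_eq_norm]
      refine (norm_sub_le _ _).trans ?_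
      have a := hM n v (hb hv)
      have b := hM n w (hKsub hw)
      linarith
    · rw [Metric.mem_ball]
      have := dist_triangle_right z w z₀
      linarith
  have : CompactSpace K := isCompact_iff_compactSpace.1 (isCompact_closedBall z₀ (r / 4))
  let F : ℕ → BoundedContinuousFunction K ℂ := fun n =>
    BoundedContinuousFunction.mkOfCompact ⟨fun z : K => f n z,
      continuousOn_iff_continuous_domRestrict.1 ((hf n).mono hKsub).continuousOn⟩
  have hFa : ∀ n (z : K), F n z = f n z := fun n z => rfl
  have hcomp : IsCompact (closure (range F)) := by
    apply BoundedContinuousFunction.arzela_ascoli (Metric.closedBall 0 M) (isCompact_closedBall _ _)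
    · rintro _ z ⟨n, rfl⟩
      rw [mem_closedBall_zero_iff, hFa]
      exact hM n z (hKsub z.2)
    · apply Metric.equicontinuous_of_continuity_modulus (fun x => (2 * M) / (3 * r / 4) * x)
      · have : Tendsto (fun x : ℝ => (2 * M) / (3 * r / 4) * x) (𝓝 0) (𝓝 ((2 * M) / (3 * r / 4) * 0)) :=
          (continuous_const.mul continuous_id).tendsto 0
        simpa using this
      · rintro x y ⟨_, n, rfl⟩
        exact hlip n x x.2 y y.2
  obtain ⟨G, -, φ, hφ, hlim⟩ := hcomp.tendsto_subseq (x := F) (fun n => subset_closure ⟨n, rfl⟩)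
  classical
  let g : ℂ → ℂ := fun z => if h : z ∈ K then G ⟨z, h⟩ else 0
  have hunif : TendstoUniformlyOn (fun n => f (φ n)) g atTop K := by
    rw [BoundedContinuousFunction.tendsto_iff_tendstoUniformly] at hlim
    rw [Metric.tendstoUniformly_iff] at hlim
    rw [Metric.tendstoUniformlyOn_iff]
    intro ε hε
    filter_upwards [hlim ε hε] with n hn z hz
    have := hn ⟨z, hz⟩
    simpa [g, hz, hFa] using this
  have hloc : TendstoLocallyUniformlyOn (fun n => f (φ n)) g atTop (Metric.ball z₀ (r / 4)) :=
    (hunif.mono Metric.ball_subset_closedBall).tendstoLocallyUniformlyOn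
  refine ⟨φ, hφ, g, ?_, hloc⟩
  exact hloc.differentiableOn (Eventually.of_forall fun n =>
    (hf (φ n)).mono (Metric.ball_subset_ball (by linarith))) Metric.isOpen_ball

lemma aux_harnack {z₀ : ℂ} {r : ℝ} (hr : 0 < r) {h : ℂ → ℂ}
    (hh : DifferentiableOn ℂ h (Metric.ball z₀ r)) (h0 : ∀ z ∈ Metric.ball z₀ r, h z ≠ 0)
    (h1 : ∀ z ∈ Metric.ball z₀ r, ‖h z‖ ≤ 1) :
    ∀ z ∈ Metric.closedBall z₀ (r / 2), ‖h z‖ ^ 3 ≤ ‖h z₀‖ := by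
  intro z hz
  have hsub : Metric.closedBall z₀ (r / 2) ⊆ Metric.ball z₀ r :=
    Metric.closedBall_subset_ball (by linarith)
  have hz₀ : z₀ ∈ Metric.ball z₀ r := Metric.mem_ball_self hr
  obtain ⟨L, hL, hLe⟩ := aux_exists_log Metric.isOpen_ball (convex_ball z₀ r) ⟨z₀, hz₀⟩ hh h0
  have hre : ∀ z ∈ Metric.ball z₀ r, (L z).re ≤ 0 := by
    intro z hz
    have := h1 z hz
    rw [← hLe z hz, Complex.norm_exp] at this
    simpa using this
  rcases (hre z₀ hz₀).eq_or_lt with ha | ha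
  · rw [← hLe z₀ hz₀, Complex.norm_exp, ha, Real.exp_zero]
    exact pow_le_one₀ (norm_nonneg _) (h1 z (hsub hz))
  · set c : ℂ := (starRingEnd ℂ) (L z₀) with hc
    have hcre : c.re = (L z₀).re := by simp [hc]
    have hcim : c.im = -(L z₀).im := by simp [hc]
    have hden : ∀ w ∈ Metric.ball z₀ r, L w + c ≠ 0 := by
      intro w hw h
      have := congrArg Complex.re h
      rw [Complex.add_re, hcre, Complex.zero_re] at this
      linarith [hre w hw]
    have hsq : ∀ w, ‖L w - L z₀‖ ^ 2 = ((L w).re - (L z₀).re) ^ 2 + ((L w).im - (L z₀).im) ^ 2 := by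
      intro w
      rw [Complex.sq_norm, Complex.normSq_apply]
      simp; ring
    have hsq2 : ∀ w, ‖L w + c‖ ^ 2 = ((L w).re + (L z₀).re) ^ 2 + ((L w).im - (L z₀).im) ^ 2 := by
      intro w
      rw [Complex.sq_norm, Complex.normSq_apply, Complex.add_re, Complex.add_im, hcre, hcim]
      ring
    have hS := Complex.dist_le_div_mul_dist_of_mapsTo_ball (f := fun w => (L w - L z₀) / (L w + c))
      (c := z₀) (R₁ := r) (R₂ := 1) (z := z)
      ((hL.sub_const _).div (hL.add_const _) hden) (by
        intro w hw
        rw [Metric.mem_closedBall, dist_eq_norm]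
        simp only [sub_self, zero_div, sub_zero]
        rw [norm_div, div_le_one (norm_pos_iff.2 (hden w hw))]
        apply le_of_sq_le_sq _ (norm_nonneg _)
        rw [hsq, hsq2]
        nlinarith [hre w hw]) (hsub hz)
    rw [dist_eq_norm] at hS
    simp only [sub_self, zero_div, sub_zero] at hS
    have hS2 : ‖L z - L z₀‖ ≤ 1 / 2 * ‖L z + c‖ := by
      rw [norm_div, div_le_iff₀ (norm_pos_iff.2 (hden z (hsub hz)))] at hS
      refine hS.trans ?_
      gcongr
      rw [Metric.mem_closedBall] at hz
      rw [div_mul_eq_mul_div, one_mul, div_le_iff₀ hr]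
      linarith
    have hS3 : ‖L z - L z₀‖ ^ 2 ≤ 1 / 4 * ‖L z + c‖ ^ 2 := by
      have := pow_le_pow_left₀ (norm_nonneg _) hS2 2
      rw [mul_pow] at this
      norm_num at this ⊢
      exact this
    rw [hsq, hsq2] at hS3
    have hzr := hre z (hsub hz)
    have hfin : 3 * (L z).re ≤ (L z₀).re := by
      by_contra hcon
      push Not at hcon
      nlinarith [sq_nonneg ((L z).im - (L z₀).im)]
    rw [← hLe z (hsub hz), ← hLe z₀ hz₀, Complex.norm_exp, Complex.norm_exp, ← Real.exp_nat_mul]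
    apply Real.exp_le_exp.2
    push_cast
    exact hfin

lemma aux_fnt {z₀ : ℂ} {r : ℝ} (hr : 0 < r) (f : ℕ → ℂ → ℂ)
    (hf : ∀ n, DifferentiableOn ℂ (f n) (Metric.ball z₀ r))
    (h0 : ∀ n, ∀ z ∈ Metric.ball z₀ r, f n z ≠ 0) (h1 : ∀ n, ∀ z ∈ Metric.ball z₀ r, f n z ≠ 1) :
    ∃ φ : ℕ → ℕ, StrictMono φ ∧
      ((∃ g : ℂ → ℂ, DifferentiableOn ℂ g (Metric.ball z₀ (r / 8)) ∧
          TendstoLocallyUniformlyOn (fun n => f (φ n)) g Filter.atTop (Metric.ball z₀ (r / 8))) ∨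
        TendstoLocallyUniformlyOnInfty (fun n => f (φ n)) (Metric.ball z₀ (r / 8))) := by
  have hsub : Metric.ball z₀ (r / 2) ⊆ Metric.ball z₀ r := Metric.ball_subset_ball (by linarith)
  by_cases hM : ∃ M, ∃ᶠ n in atTop, ‖f n z₀‖ ≤ M
  · obtain ⟨M, hM⟩ := hM
    obtain ⟨ψ, hψ, hψM⟩ := extraction_of_frequently_atTop hM
    obtain ⟨S, -, hS⟩ := aux_schottky M
    obtain ⟨φ, hφ, g, hg, hlim⟩ := aux_montel (z₀ := z₀) (r := r / 2) (M := S) (by linarith)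
      (fun n => f (ψ n)) (fun n => (hf _).mono hsub)
      (fun n z hz => hS z₀ r (f (ψ n)) hr (hf _) (h0 _) (h1 _) (hψM n) z
        (Metric.ball_subset_closedBall hz))
    have e : r / 2 / 4 = r / 8 := by ring
    rw [e] at hg hlim
    exact ⟨ψ ∘ φ, hψ.comp hφ, Or.inl ⟨g, hg, hlim⟩⟩
  · push Not at hM
    refine ⟨id, strictMono_id, Or.inr ?_⟩
    obtain ⟨S, hSpos, hS⟩ := aux_schottky 1
    intro K hK _ M
    filter_upwards [hM 1, hM ((S * |M|) ^ 3 / S)] with n hn1 hn2 z hz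
    have hinv : ∀ z ∈ Metric.closedBall z₀ (r / 2), ‖(f n z)⁻¹‖ ≤ S := by
      apply hS z₀ r (fun z => (f n z)⁻¹) hr ((hf n).inv (h0 n))
      · intro z hz; exact inv_ne_zero (h0 n z hz)
      · intro z hz h
        exact h1 n z hz (inv_eq_one.1 h)
      · rw [norm_inv]; exact inv_le_one_of_one_le₀ hn1.le
    have hH := aux_harnack (z₀ := z₀) (r := r / 2) (by linarith) (h := fun z => (f n z)⁻¹ / S)
      ((((hf n).inv (h0 n)).mono hsub).div_const _)
      (fun z hz => div_ne_zero (inv_ne_zero (h0 n z (hsub hz))) (by exact_mod_cast hSpos.ne'))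
      (fun z hz => by
        rw [norm_div, Complex.norm_real, Real.norm_of_nonneg hSpos.le, div_le_one hSpos]
        exact hinv z (Metric.ball_subset_closedBall hz)) z
      (Metric.ball_subset_closedBall (Metric.ball_subset_ball (by linarith) (hK hz)))
    have hzb : z ∈ Metric.ball z₀ r := Metric.ball_subset_ball (by linarith) (hK hz)
    have hp1 : 0 < ‖f n z‖ := norm_pos_iff.2 (h0 n z hzb)
    have hp0 : 0 < ‖f n z₀‖ := norm_pos_iff.2 (h0 n z₀ (Metric.mem_ball_self hr))
    simp only [norm_div, norm_inv, Complex.norm_real, Real.norm_of_nonneg hSpos.le] at hH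
    have e1 : (‖f n z‖⁻¹ / S) ^ 3 = ((S * ‖f n z‖) ^ 3)⁻¹ := by field_simp
    have e2 : ‖f n z₀‖⁻¹ / S = (S * ‖f n z₀‖)⁻¹ := by field_simp
    rw [e1, e2, inv_le_inv₀ (by positivity) (by positivity)] at hH
    have h3 : (S * |M|) ^ 3 ≤ (S * ‖f n z‖) ^ 3 := by
      rw [div_lt_iff₀ hSpos] at hn2
      linarith
    have h4 : S * |M| ≤ S * ‖f n z‖ := le_of_pow_le_pow_left₀ (by norm_num) (by positivity) h3
    exact (le_abs_self M).trans (le_of_mul_le_mul_left h4 hSpos)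

lemma aux_normal (𝓕 : Set (ℂ → ℂ)) (hd : ∀ f ∈ 𝓕, Differentiable ℂ f) {z₀ a b : ℂ} (hab : a ≠ b)
    {r : ℝ} (hr : 0 < r) (ha : ∀ f ∈ 𝓕, ∀ z ∈ Metric.ball z₀ r, f z ≠ a)
    (hb : ∀ f ∈ 𝓕, ∀ z ∈ Metric.ball z₀ r, f z ≠ b) : NormalAt univ 𝓕 z₀ := by
  have hba : b - a ≠ 0 := sub_ne_zero.2 hab.symm
  refine ⟨Metric.ball z₀ (r / 8), subset_univ _, Metric.ball_mem_nhds _ (by linarith), ?_⟩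
  intro f hf
  obtain ⟨φ, hφ, h⟩ := aux_fnt hr (fun n z => (f n z - a) / (b - a))
    (fun n => (((hd _ (hf n)).sub_const a).div_const _).differentiableOn)
    (fun n z hz => div_ne_zero (sub_ne_zero.2 (ha _ (hf n) z hz)) hba)
    (fun n z hz h => hb _ (hf n) z hz (by
      rw [div_eq_one_iff_eq hba] at h
      linear_combination h))
  refine ⟨φ, hφ, ?_⟩
  have e : ∀ w : ℂ, a + (b - a) * ((w - a) / (b - a)) = w := by
    intro w; field_simp; ring
  rcases h with ⟨g, hg, hlim⟩ | hlim
  · left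
    refine ⟨fun z => a + (b - a) * g z, (hg.const_mul _).const_add _, ?_⟩
    have huc : UniformContinuous (fun w : ℂ => a + (b - a) * w) :=
      uniformContinuous_const.add (uniformContinuous_id.const_mul' _)
    have := huc.comp_tendstoLocallyUniformlyOn hlim
    refine this.congr fun n z hz => ?_
    exact e _
  · right
    intro K hK hKc M
    filter_upwards [hlim K hK hKc ((M + ‖a‖) / ‖b - a‖)] with n hn z hz
    have h1 := hn z hz
    rw [norm_div] at h1
    have h2 : M + ‖a‖ ≤ ‖f (φ n) z - a‖ := (div_le_div_iff_of_pos_right (norm_pos_iff.2 hba)).1 h1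
    have h3 := norm_sub_le (f (φ n) z) a
    linarith

lemma aux_openMap {f : ℂ → ℂ} (hf : TranscendentalEntire f) : IsOpenMap f := by
  rcases AnalyticOnNhd.is_constant_or_isOpenMap (g := f) (fun z _ => hf.1.analyticAt z) with h | h
  · obtain ⟨w, hw⟩ := h
    exact absurd ⟨Polynomial.C w, fun z => by simp [hw z]⟩ hf.2
  · exact h

lemma aux_iterate_mem {𝓕 : Set (ℂ → ℂ)} (hsemi : ∀ f ∈ 𝓕, ∀ g ∈ 𝓕, f ∘ g ∈ 𝓕) {f : ℂ → ℂ}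
    (hf : f ∈ 𝓕) (n : ℕ) : f^[n + 1] ∈ 𝓕 := by
  induction n with
  | zero => simpa using hf
  | succ n ih =>
    rw [Function.iterate_succ']
    exact hsemi f hf _ ih

lemma aux_iterate_inj {𝓕 : Set (ℂ → ℂ)} (htra : ∀ f ∈ 𝓕, TranscendentalEntire f)
    (hsemi : ∀ f ∈ 𝓕, ∀ g ∈ 𝓕, f ∘ g ∈ 𝓕) {f : ℂ → ℂ}
    (hf : f ∈ 𝓕) : Function.Injective (fun n : ℕ => f^[n + 1]) := by
  have key : ∀ m k : ℕ, f^[m + 1] ≠ f^[m + k + 1 + 1] := by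
    intro m k h
    have hm := htra _ (aux_iterate_mem hsemi hf m)
    have hk := htra _ (aux_iterate_mem hsemi hf k)
    have h1 : ∀ z ∈ range f^[m + 1], f^[k + 1] z = z := by
      rintro _ ⟨z, rfl⟩
      rw [← Function.iterate_add_apply]
      have : k + 1 + (m + 1) = m + k + 1 + 1 := by ring
      rw [this, ← h]
    have h2 : f^[k + 1] = fun z => z := by
      apply AnalyticOnNhd.eq_of_eventuallyEq (𝕜 := ℂ) (z₀ := f^[m + 1] 0)
        (fun z _ => hk.1.analyticAt z) (fun z _ => analyticAt_id)
      filter_upwards [(aux_openMap hm).isOpen_range.mem_nhds (mem_range_self 0)] with z hz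
      exact h1 z hz
    exact hk.2 ⟨Polynomial.X, fun z => by rw [h2]; simp⟩
  intro m n h
  simp only at h
  rcases lt_trichotomy m n with hlt | heq | hlt
  · obtain ⟨k, rfl⟩ := Nat.exists_eq_add_of_lt hlt
    exact absurd h (key m k)
  · exact heq
  · obtain ⟨k, rfl⟩ := Nat.exists_eq_add_of_lt hlt
    exact absurd h.symm (key n k)

lemma aux_fixed_notMem {𝓕 : Set (ℂ → ℂ)} (htra : ∀ f ∈ 𝓕, TranscendentalEntire f)
    (hsemi : ∀ f ∈ 𝓕, ∀ g ∈ 𝓕, f ∘ g ∈ 𝓕) {f : ℂ → ℂ}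
    (hf : f ∈ 𝓕) {p : ℂ} (hp : f p = p) : p ∉ EscapingSet univ 𝓕 := by
  rintro ⟨-, h⟩
  have h1 := h (fun n => f^[n + 1]) (fun n => aux_iterate_mem hsemi hf n)
    (aux_iterate_inj htra hsemi hf)
  have h2 : (fun n : ℕ => ‖f^[n + 1] p‖) = fun _ => ‖p‖ := by
    funext n
    rw [Function.iterate_fixed hp]
  simp only [h2] at h1
  exact not_tendsto_const_atTop _ _ h1

lemma aux_exists_notMem {𝓕 : Set (ℂ → ℂ)} (htra : ∀ f ∈ 𝓕, TranscendentalEntire f)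
    (hsemi : ∀ f ∈ 𝓕, ∀ g ∈ 𝓕, f ∘ g ∈ 𝓕) {f : ℂ → ℂ}
    (hf : f ∈ 𝓕) : ∃ p, p ∉ EscapingSet univ 𝓕 := by
  by_contra hcon
  push Not at hcon
  have hfd : Differentiable ℂ f := (htra f hf).1
  have hfix : ∀ z, f z - z ≠ 0 := fun z h =>
    aux_fixed_notMem htra hsemi hf (sub_eq_zero.1 h) (hcon z)
  have hfix2 : ∀ z, f (f z) - z ≠ 0 := fun z h =>
    aux_fixed_notMem htra hsemi (hsemi f hf f hf) (p := z) (sub_eq_zero.1 h) (hcon z)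
  have hconst := aux_picard (f := fun z => (f (f z) - z) / (f z - z))
    (((hfd.comp hfd).sub differentiable_id).div (hfd.sub differentiable_id) hfix)
    (fun z => div_ne_zero (hfix2 z) (hfix z))
    (fun z h => by
      rw [div_eq_one_iff_eq (hfix z)] at h
      exact hfix (f z) (by linear_combination h))
  obtain ⟨c, hc⟩ : ∃ c, c = (f (f 0) - 0) / (f 0 - 0) := ⟨_, rfl⟩
  have hc0 : c ≠ 0 := by rw [hc]; exact div_ne_zero (hfix2 0) (hfix 0)
  have hc1 : c ≠ 1 := by
    rw [hc]; intro h
    rw [div_eq_one_iff_eq (hfix 0)] at h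
    exact hfix (f 0) (by linear_combination h)
  have heq : ∀ z, f (f z) - z = c * (f z - z) := by
    intro z
    have h := hconst z 0
    rw [← hc, div_eq_iff (hfix z)] at h
    exact h
  have hder : ∀ z, deriv f z * (deriv f (f z) - c) = 1 - c := by
    intro z
    have d1 : HasDerivAt (fun z => f (f z) - z) (deriv f (f z) * deriv f z - 1) z :=
      ((hfd (f z)).hasDerivAt.comp z (hfd z).hasDerivAt).sub (hasDerivAt_id z)
    have d2 : HasDerivAt (fun z => c * (f z - z)) (c * (deriv f z - 1)) z :=
      (((hfd z).hasDerivAt).sub (hasDerivAt_id z)).const_mul c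
    rw [← funext heq] at d2
    have := d1.unique d2
    linear_combination this
  have hne : ∀ z, deriv f z ≠ 0 ∧ deriv f (f z) - c ≠ 0 := by
    intro z
    apply mul_ne_zero_iff.1
    rw [hder z]
    exact sub_ne_zero.2 hc1.symm
  have hdd : Differentiable ℂ (deriv f) := by
    rw [← differentiableOn_univ]
    exact hfd.differentiableOn.deriv isOpen_univ
  have hconst2 := aux_picard (f := fun z => deriv f (f z) / c)
    ((hdd.comp hfd).div_const c) (fun z => div_ne_zero (hne (f z)).1 hc0)
    (fun z h => by
      rw [div_eq_one_iff_eq hc0] at h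
      exact (hne z).2 (by rw [h, sub_self]))
  have hconst3 : ∀ z, deriv f (f z) = deriv f (f 0) := by
    intro z
    have := hconst2 z 0
    exact (div_left_inj' hc0).1 this
  have hdc : deriv f = fun _ => deriv f (f 0) := by
    apply AnalyticOnNhd.eq_of_eventuallyEq (𝕜 := ℂ) (z₀ := f 0)
      (fun z _ => hdd.analyticAt z) (fun z _ => analyticAt_const)
    filter_upwards [(aux_openMap (htra f hf)).isOpen_range.mem_nhds (mem_range_self 0)]
    rintro _ ⟨w, rfl⟩
    exact hconst3 w
  obtain ⟨d, hd⟩ : ∃ d, d = deriv f (f 0) := ⟨_, rfl⟩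
  rw [← hd] at hdc
  have hlin : ∀ z, f z - d * z = f 0 - d * 0 := by
    intro z
    refine is_const_of_deriv_eq_zero (f := fun z => f z - d * z)
      (hfd.sub (differentiable_id.const_mul d)) ?_ z 0
    intro w
    have : HasDerivAt (fun z => f z - d * z) (deriv f w - d * 1) w :=
      (hfd w).hasDerivAt.sub ((hasDerivAt_id w).const_mul d)
    rw [this.deriv, hdc]
    ring
  refine (htra f hf).2 ⟨Polynomial.C d * Polynomial.X + Polynomial.C (f 0), fun z => ?_⟩
  simp
  linear_combination hlin z

lemma aux_exists_two {𝓕 : Set (ℂ → ℂ)} (hne : 𝓕.Nonempty)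
    (htra : ∀ f ∈ 𝓕, TranscendentalEntire f)
    (hsemi : ∀ f ∈ 𝓕, ∀ g ∈ 𝓕, f ∘ g ∈ 𝓕)
    (hfwd : ∀ f ∈ 𝓕, f '' EscapingSet Set.univ 𝓕 ⊆ EscapingSet Set.univ 𝓕)
    (hback : ∀ f ∈ 𝓕, f ⁻¹' EscapingSet Set.univ 𝓕 ⊆ EscapingSet Set.univ 𝓕) :
    ∃ p q, p ≠ q ∧ p ∉ EscapingSet univ 𝓕 ∧ q ∉ EscapingSet univ 𝓕 := by
  obtain ⟨f, hf⟩ := hne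
  obtain ⟨p, hp⟩ := aux_exists_notMem htra hsemi hf
  by_contra hcon
  push Not at hcon
  have huniq : ∀ q, q ∉ EscapingSet univ 𝓕 → q = p := by
    intro q hq
    by_contra h
    exact hq (hcon p q (Ne.symm h) hp)
  have hfd : Differentiable ℂ f := (htra f hf).1
  have hfp : f p = p := huniq _ (fun h => hp (hback f hf h))
  have hpre : ∀ z, f z = p → z = p := fun z hz =>
    huniq z (fun h => hp (hz ▸ hfwd f hf (mem_image_of_mem f h)))
  have hfix : ∀ z, f z = z → z = p := fun z hz => huniq z (aux_fixed_notMem htra hsemi hf hz)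
  have hne : ∀ w, p + Complex.exp w ≠ p := fun w h => Complex.exp_ne_zero w (by simpa using h)
  have hconst := aux_picard (f := fun w => (f (p + Complex.exp w) - p) / Complex.exp w)
    (((hfd.comp (Complex.differentiable_exp.const_add p)).sub_const p).div
      Complex.differentiable_exp Complex.exp_ne_zero)
    (fun w => div_ne_zero (fun h => hne w (hpre _ (sub_eq_zero.1 h))) (Complex.exp_ne_zero w))
    (fun w h => by
      rw [div_eq_one_iff_eq (Complex.exp_ne_zero w)] at h
      exact hne w (hfix _ (by linear_combination h)))
  obtain ⟨c, hc⟩ : ∃ c, c = (f (p + Complex.exp 0) - p) / Complex.exp 0 := ⟨_, rfl⟩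
  refine (htra f hf).2 ⟨Polynomial.C c * (Polynomial.X - Polynomial.C p) + Polynomial.C p,
    fun z => ?_⟩
  simp
  by_cases hz : z = p
  · rw [hz, hfp]; ring
  · have h := hconst (Complex.log (z - p)) 0
    rw [← hc, div_eq_iff (Complex.exp_ne_zero _), Complex.exp_log (sub_ne_zero.2 hz),
      add_sub_cancel] at h
    linear_combination h

/-- If `𝓕` is a semigroup of transcendental entire functions whose
escaping like set `I(𝓕)` has at least two points and is both forward and backward
invariant, then `J(𝓕) = ∂I(𝓕)` (boundary in `ℂ`). -/
theorem julia_eq_frontier_escaping (𝓕 : Set (ℂ → ℂ))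
    (hne : 𝓕.Nonempty)
    (htra : ∀ f ∈ 𝓕, TranscendentalEntire f)
    (hsemi : ∀ f ∈ 𝓕, ∀ g ∈ 𝓕, f ∘ g ∈ 𝓕)
    (htwo : ∃ a ∈ EscapingSet Set.univ 𝓕, ∃ b ∈ EscapingSet Set.univ 𝓕, a ≠ b)
    (hfwd : ∀ f ∈ 𝓕, f '' EscapingSet Set.univ 𝓕 ⊆ EscapingSet Set.univ 𝓕)
    (hback : ∀ f ∈ 𝓕, f ⁻¹' EscapingSet Set.univ 𝓕 ⊆ EscapingSet Set.univ 𝓕) :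
    JuliaSet Set.univ 𝓕 = frontier (EscapingSet Set.univ 𝓕) := by
  have hd : ∀ f ∈ 𝓕, Differentiable ℂ f := fun f hf => (htra f hf).1
  rw [frontier_eq_closure_inter_closure]
  apply Subset.antisymm
  · rintro z ⟨-, hz⟩
    have hz' : ¬ NormalAt univ 𝓕 z := fun h => hz ⟨mem_univ _, h⟩
    constructor
    · rw [Metric.mem_closure_iff]
      by_contra hcon
      push Not at hcon
      obtain ⟨r, hr, hdis⟩ := hcon
      obtain ⟨a, ha, b, hb, hab⟩ := htwo
      have key : ∀ f ∈ 𝓕, ∀ w ∈ Metric.ball z r, f w ∉ EscapingSet univ 𝓕 := by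
        intro f hf w hw h
        have := hdis w (hback f hf h)
        rw [Metric.mem_ball, dist_comm] at hw
        linarith
      exact hz' (aux_normal 𝓕 hd hab hr (fun f hf w hw h => key f hf w hw (h ▸ ha))
        (fun f hf w hw h => key f hf w hw (h ▸ hb)))
    · rw [Metric.mem_closure_iff]
      by_contra hcon
      push Not at hcon
      obtain ⟨r, hr, hdis⟩ := hcon
      obtain ⟨a, b, hab, ha, hb⟩ := aux_exists_two hne htra hsemi hfwd hback
      have key : ∀ f ∈ 𝓕, ∀ w ∈ Metric.ball z r, f w ∈ EscapingSet univ 𝓕 := by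
        intro f hf w hw
        apply hfwd f hf
        apply mem_image_of_mem
        by_contra h
        have := hdis w h
        rw [Metric.mem_ball, dist_comm] at hw
        linarith
      exact hz' (aux_normal 𝓕 hd hab hr (fun f hf w hw h => ha (h ▸ key f hf w hw))
        (fun f hf w hw h => hb (h ▸ key f hf w hw)))
  · rintro z ⟨hz1, hz2⟩
    refine ⟨mem_univ _, ?_⟩
    rintro ⟨-, N, -, hN, hnorm⟩
    obtain ⟨a, haN, ha⟩ := mem_closure_iff_nhds.1 hz1 N hN
    obtain ⟨b, hbN, hb⟩ := mem_closure_iff_nhds.1 hz2 N hN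
    apply hb
    refine ⟨mem_univ _, fun f hf hinj => ?_⟩
    by_contra hnt
    rw [tendsto_atTop] at hnt
    push Not at hnt
    obtain ⟨M, hM⟩ := hnt
    obtain ⟨ψ, hψ, hψM⟩ := extraction_of_frequently_atTop hM
    obtain ⟨φ, hφ, h⟩ := hnorm (fun n => f (ψ n)) (fun n => hf _)
    rcases h with ⟨g, -, hlim⟩ | hlim
    · have h1 : Tendsto (fun n => f (ψ (φ n)) a) atTop (𝓝 (g a)) := hlim.tendsto_at haN
      have h2 := ha.2 (fun n => f (ψ (φ n))) (fun n => hf _)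
        (hinj.comp (hψ.injective.comp hφ.injective))
      exact not_tendsto_atTop_of_tendsto_nhds h1.norm h2
    · have h1 := hlim {b} (singleton_subset_iff.2 hbN) isCompact_singleton M
      obtain ⟨n, hn⟩ := h1.exists
      have h2 := hn b rfl
      exact absurd h2 (not_le.2 (hψM (φ n)))
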